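/- arXiv:2005.05759 — 3 statements merged into one kernel-verified Lean document; each statement's English description precedes it below -/
import Mathlib

section
/- Let I ⊆ ℂ[x,y] be an ideal with dim_ℂ ℂ[x,y]/I = n < ∞, and suppose I is generated as an ideal by a family {f_i} such that (f_i)⁰ = (f_i)₀ for every i, and such that I₀ equals the ℂ-linear span of {(x^a y^b f_i)₀ : a,b ∈ ℕ, all i}. Then I⁰ = I₀, and moreover 𝔪^n ⊆ I, i.e. I ∈ H^(n). -/
/- STATEMENT 5: If dim ℂ[x,y]/I = n < ∞ and I is generated by a family {f_i} with
(f_i)⁰ = (f_i)₀ for all i, and I₀ equals the ℂ-span of {(x^a y^b f_i)₀ : a,b ∈ ℕ, all i},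
then I⁰ = I₀ and 𝔪^n ⊆ I, i.e. I ∈ H^(n). -/

noncomputable section
open MvPolynomial

/-- The polynomial ring ℂ[x,y], with x = X 0 and y = X 1. -/
abbrev Rp : Type := MvPolynomial (Fin 2) ℂ

/-- The exponent vector of the monomial x^a y^b. -/
def expPair (a b : ℕ) : Fin 2 →₀ ℕ := Finsupp.single 0 a + Finsupp.single 1 b

/-- The monomial x^a y^b. -/
def mn (a b : ℕ) : Rp := monomial (expPair a b) (1 : ℂ)

/-- The coefficient of x^a y^b in f. -/
def cf (f : Rp) (a b : ℕ) : ℂ := coeff (expPair a b) f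

/-- x^a y^b is the largest monomial occurring in f for the order {y^∞<x}. -/
def IsLead (f : Rp) (a b : ℕ) : Prop :=
  cf f a b ≠ 0 ∧ ∀ a' b' : ℕ, cf f a' b' ≠ 0 → a' < a ∨ (a' = a ∧ b' ≤ b)

/-- x^a y^b is the smallest monomial occurring in f for the order {x^∞<y}. -/
def IsLow (f : Rp) (a b : ℕ) : Prop :=
  cf f a b ≠ 0 ∧ ∀ a' b' : ℕ, cf f a' b' ≠ 0 → b < b' ∨ (b = b' ∧ a ≤ a')

/-- I⁰ : the ℂ-linear span of the leading monomials of the nonzero f ∈ I. -/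
def Itop (I : Ideal Rp) : Submodule ℂ Rp :=
  Submodule.span ℂ {g : Rp | ∃ f ∈ I, ∃ a b : ℕ, IsLead f a b ∧ g = mn a b}

/-- I₀ : the ℂ-linear span of the minimal monomials of the nonzero f ∈ I. -/
def Ibot (I : Ideal Rp) : Submodule ℂ Rp :=
  Submodule.span ℂ {g : Rp | ∃ f ∈ I, ∃ a b : ℕ, IsLow f a b ∧ g = mn a b}

/-- The maximal ideal 𝔪 = (x,y) of the origin. -/
def mId : Ideal Rp := Ideal.span {X 0, X 1}

lemma expPair_eta (s : Fin 2 →₀ ℕ) : expPair (s 0) (s 1) = s := by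
  ext i
  fin_cases i <;> simp [expPair]

@[simp] lemma expPair_apply_zero (a b : ℕ) : expPair a b 0 = a := by simp [expPair]

@[simp] lemma expPair_apply_one (a b : ℕ) : expPair a b 1 = b := by simp [expPair]

lemma expPair_inj {a b a' b' : ℕ} : expPair a b = expPair a' b' ↔ a = a' ∧ b = b' := by
  refine ⟨fun h => ⟨?_, ?_⟩, by rintro ⟨rfl, rfl⟩; rfl⟩
  · simpa using DFunLike.congr_fun h 0
  · simpa using DFunLike.congr_fun h 1

lemma expPair_add (a b p q : ℕ) : expPair (p + a) (q + b) = expPair p q + expPair a b := by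
  simp only [expPair, Finsupp.single_add]
  abel

lemma mn_eq (a b : ℕ) : mn a b = X 0 ^ a * X 1 ^ b := by
  simp [mn, expPair, X_pow_eq_monomial, monomial_mul]

lemma cf_mn (a b a' b' : ℕ) : cf (mn a b) a' b' = if a = a' ∧ b = b' then 1 else 0 := by
  simp [cf, mn, coeff_monomial, expPair_inj]

lemma cf_mn_mul (p q a b : ℕ) (f : Rp) : cf (mn p q * f) (p + a) (q + b) = cf f a b := by
  simp [cf, mn, expPair_add, coeff_monomial_mul]

lemma exists_of_cf_mn_mul_ne_zero {p q a b : ℕ} {f : Rp} (h : cf (mn p q * f) a b ≠ 0) :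
    ∃ a' b', a = p + a' ∧ b = q + b' ∧ cf f a' b' ≠ 0 := by
  have hle : expPair p q ≤ expPair a b := by
    by_contra hn
    exact h (by simp [cf, mn, coeff_monomial_mul', hn])
  have h0 : p ≤ a := by simpa using hle 0
  have h1 : q ≤ b := by simpa using hle 1
  obtain ⟨a', rfl⟩ := Nat.exists_eq_add_of_le h0
  obtain ⟨b', rfl⟩ := Nat.exists_eq_add_of_le h1
  exact ⟨a', b', rfl, rfl, by rwa [cf_mn_mul] at h⟩

/-- A submodule containing all monomials occurring in `f` contains `f`. -/
lemma mem_of_forall_mn_mem {W : Submodule ℂ Rp} {f : Rp}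
    (h : ∀ a b, cf f a b ≠ 0 → mn a b ∈ W) : f ∈ W := by
  rw [f.as_sum]
  refine W.sum_mem fun s hs => ?_
  have := W.smul_mem (coeff s f) (h (s 0) (s 1) (by rw [cf, expPair_eta]; exact mem_support_iff.1 hs))
  rwa [mn, expPair_eta, smul_monomial, smul_eq_mul, mul_one] at this

/-- Every element of a span of monomials is supported on these monomials. -/
lemma of_mem_span_mn {P : ℕ → ℕ → Prop} {g : Rp}
    (hg : g ∈ Submodule.span ℂ {g : Rp | ∃ a b, P a b ∧ g = mn a b}) {a b : ℕ}
    (h : cf g a b ≠ 0) : P a b := by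
  by_contra hP
  apply h
  clear h
  induction hg using Submodule.span_induction with
  | mem x hx =>
    obtain ⟨a', b', hP', rfl⟩ := hx
    rw [cf_mn, if_neg]
    rintro ⟨rfl, rfl⟩
    exact hP hP'
  | zero => simp [cf]
  | add x y _ _ hx hy => rw [cf, coeff_add, ← cf, ← cf, hx, hy, add_zero]
  | smul c x _ hx => simpa [cf] using Or.inr hx

lemma IsLow.unique {f : Rp} {a b a' b' : ℕ} (h : IsLow f a b) (h' : IsLow f a' b') :
    a = a' ∧ b = b' := by
  have h₁ := h.2 _ _ h'.1
  have h₂ := h'.2 _ _ h.1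
  omega

lemma IsLow.mn_mul {f : Rp} {a b : ℕ} (h : IsLow f a b) (p q : ℕ) :
    IsLow (mn p q * f) (p + a) (q + b) := by
  refine ⟨by rw [cf_mn_mul]; exact h.1, fun a' b' h' => ?_⟩
  obtain ⟨c, d, rfl, rfl, hcd⟩ := exists_of_cf_mn_mul_ne_zero h'
  have := h.2 _ _ hcd
  omega

lemma IsLead.mn_mul {f : Rp} {a b : ℕ} (h : IsLead f a b) (p q : ℕ) :
    IsLead (mn p q * f) (p + a) (q + b) := by
  refine ⟨by rw [cf_mn_mul]; exact h.1, fun a' b' h' => ?_⟩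
  obtain ⟨c, d, rfl, rfl, hcd⟩ := exists_of_cf_mn_mul_ne_zero h'
  have := h.2 _ _ hcd
  omega

lemma exists_cf_ne_zero {f : Rp} (hf : f ≠ 0) : ∃ a b, cf f a b ≠ 0 := by
  obtain ⟨s, hs⟩ := ne_zero_iff.1 hf
  exact ⟨s 0, s 1, by rwa [cf, expPair_eta]⟩

lemma exists_isLow {f : Rp} (hf : f ≠ 0) : ∃ a b, IsLow f a b := by
  obtain ⟨s, hs, hmin⟩ := Finset.exists_min_image f.support
    (fun s => toLex (s 1, s 0)) (support_nonempty.2 hf)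
  refine ⟨s 0, s 1, by rw [cf, expPair_eta]; exact mem_support_iff.1 hs, fun a b h => ?_⟩
  have := hmin (expPair a b) (mem_support_iff.2 h)
  simpa [Prod.Lex.toLex_le_toLex] using this

/-- Division with remainder: modulo `I`, every monomial is a combination of monomials which are
not leading monomials of elements of `I`. -/
lemma mn_mem_sup_span_not_lead (I : Ideal Rp) (a b : ℕ) :
    mn a b ∈ I.restrictScalars ℂ ⊔
      Submodule.span ℂ {g : Rp | ∃ a b, (¬ ∃ f ∈ I, IsLead f a b) ∧ g = mn a b} := by
  set W := I.restrictScalars ℂ ⊔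
      Submodule.span ℂ {g : Rp | ∃ a b, (¬ ∃ f ∈ I, IsLead f a b) ∧ g = mn a b}
  induction a using Nat.strong_induction_on generalizing b with
  | _ a iha =>
  induction b using Nat.strong_induction_on with
  | _ b ihb =>
  by_cases h : ∃ f ∈ I, IsLead f a b
  · obtain ⟨f, hfI, hf⟩ := h
    have hrest : f - cf f a b • mn a b ∈ W := by
      refine mem_of_forall_mn_mem fun a' b' h' => ?_
      have hc : cf (f - cf f a b • mn a b) a' b' =
          cf f a' b' - cf f a b * if a = a' ∧ b = b' then 1 else 0 := by
        rw [← cf_mn]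
        simp [cf]
      rw [hc] at h'
      by_cases he : a = a' ∧ b = b'
      · obtain ⟨rfl, rfl⟩ := he
        simp at h'
      · rw [if_neg he, mul_zero, sub_zero] at h'
        rcases hf.2 _ _ h' with hlt | ⟨rfl, hle⟩
        · exact iha _ hlt _
        · exact ihb _ (by omega)
    have hfW : f ∈ W := Submodule.mem_sup_left hfI
    have := W.sub_mem hfW hrest
    rw [sub_sub_cancel] at this
    exact (W.smul_mem_iff hf.1).1 this
  · exact Submodule.mem_sup_right (Submodule.subset_span ⟨a, b, h, rfl⟩)

/-- If every low monomial of `I` is a leading monomial of `I`, then the converse holds too. -/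
lemma exists_isLow_of_isLead {I : Ideal Rp}
    (hsub : ∀ a b, (∃ f ∈ I, IsLow f a b) → ∃ f ∈ I, IsLead f a b) {a b : ℕ}
    (h : ∃ f ∈ I, IsLead f a b) : ∃ f ∈ I, IsLow f a b := by
  by_contra hlow
  obtain ⟨u, hu, v, hv, huv⟩ := Submodule.mem_sup.1 (mn_mem_sup_span_not_lead I a b)
  have hcf : ∀ a' b', cf u a' b' = (if a = a' ∧ b = b' then 1 else 0) - cf v a' b' := by
    intro a' b'
    rw [← cf_mn, ← huv]
    simp [cf]
  have hv0 : cf v a b = 0 := by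
    by_contra hne
    exact of_mem_span_mn hv hne h
  have hune : u ≠ 0 := by
    rintro rfl
    have := hcf a b
    simp [hv0] at this
    simp [cf] at this
  obtain ⟨p, q, hpq⟩ := exists_isLow hune
  have hS : ∃ f ∈ I, IsLow f p q := ⟨u, hu, hpq⟩
  have hne := hpq.1
  rw [hcf] at hne
  by_cases he : a = p ∧ b = q
  · obtain ⟨rfl, rfl⟩ := he
    exact hlow hS
  · rw [if_neg he, zero_sub, neg_ne_zero] at hne
    exact of_mem_span_mn hv hne (hsub _ _ hS)

/-- If `I` has finite codimension, then for each family `k ↦ x^(a k) y^(b k)` of distinct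
monomials, some member is a low monomial of `I`. -/
lemma exists_isLow_of_injective {I : Ideal Rp} [FiniteDimensional ℂ (Rp ⧸ I)] {a b : ℕ → ℕ}
    (hinj : Function.Injective fun k => expPair (a k) (b k)) :
    ∃ k, ∃ f ∈ I, IsLow f (a k) (b k) := by
  have hdep : ¬ LinearIndependent ℂ fun k => Ideal.Quotient.mkₐ ℂ I (mn (a k) (b k)) :=
    fun h => not_finite_iff_infinite.2 inferInstance h.finite
  rw [linearIndependent_iff'] at hdep
  push Not at hdep
  obtain ⟨s, g, hsum, k, hk, hgk⟩ := hdep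
  have hcf : ∀ p q, cf (∑ k ∈ s, g k • mn (a k) (b k)) p q =
      ∑ k ∈ s, g k * if a k = p ∧ b k = q then 1 else 0 := by
    intro p q
    simp_rw [← cf_mn]
    simp [cf, coeff_sum]
  have hne : (∑ k ∈ s, g k • mn (a k) (b k)) ≠ 0 := by
    intro h0
    have := hcf (a k) (b k)
    rw [h0, Finset.sum_eq_single k] at this
    · simp [cf] at this
      exact hgk this.symm
    · intro j _ hj
      rw [if_neg, mul_zero]
      exact fun h => hj (hinj (expPair_inj.2 h))
    · exact fun h => absurd hk h
  have hmem : (∑ k ∈ s, g k • mn (a k) (b k)) ∈ I := by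
    rw [← Ideal.Quotient.eq_zero_iff_mem, ← Ideal.Quotient.mkₐ_eq_mk ℂ, map_sum]
    simpa only [map_smul] using hsum
  obtain ⟨p, q, hpq⟩ := exists_isLow hne
  have hne' := hpq.1
  rw [hcf] at hne'
  obtain ⟨j, _, hj⟩ := Finset.exists_ne_zero_of_sum_ne_zero hne'
  have : a j = p ∧ b j = q := by
    by_contra h
    simp [h] at hj
  obtain ⟨rfl, rfl⟩ := this
  exact ⟨j, _, hmem, hpq⟩

/-- A nilpotent ideal `J` of an algebra of finite dimension `n` over a field satisfies
`J ^ n = 0`. -/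
lemma pow_finrank_eq_bot_of_isNilpotent {K A : Type*} [Field K] [CommRing A] [Algebra K A]
    [FiniteDimensional K A] {J : Ideal A} (hJ : IsNilpotent J) :
    J ^ Module.finrank K A = ⊥ := by
  obtain ⟨r, hr⟩ := hJ
  have key : ∀ m, J ^ m = ⊥ ∨
      Module.finrank K ((J ^ m).restrictScalars K) + m ≤ Module.finrank K A := by
    intro m
    induction m with
    | zero => exact Or.inr (Submodule.finrank_le _)
    | succ m ih =>
      by_cases hm : J ^ m = ⊥
      · left
        rw [pow_succ, hm, Ideal.bot_mul]
      · have ih := ih.resolve_left hm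
        have hne : J ^ (m + 1) ≠ J ^ m := by
          intro he
          have hstab : ∀ k, J ^ (m + k) = J ^ m := by
            intro k
            induction k with
            | zero => rfl
            | succ k ihk => rw [← add_assoc, pow_succ, ihk, ← pow_succ, he]
          exact hm (by rw [← hstab r, pow_add, hr, mul_zero]; rfl)
        have hlt : (J ^ (m + 1)).restrictScalars K < (J ^ m).restrictScalars K :=
          lt_of_le_of_ne (fun x hx => Ideal.pow_le_pow_right m.le_succ hx)
            fun h => hne (Submodule.restrictScalars_injective K _ _ h)
        have := Submodule.finrank_lt_finrank_of_lt hlt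
        right
        omega
  rcases key (Module.finrank K A) with h | h
  · exact h
  · have h0 : Module.finrank K ((J ^ Module.finrank K A).restrictScalars K) = 0 := by omega
    rw [Submodule.finrank_eq_zero] at h0
    exact (Submodule.restrictScalars_eq_bot_iff _ _ _).1 h0

/-- If `f⁰ = f₀ = y^b` then `y^b` lies in every ideal containing `f`. -/
lemma X_one_pow_mem {I : Ideal Rp} {f : Rp} (hf : f ∈ I) {b : ℕ} (hlead : IsLead f 0 b)
    (hlow : IsLow f 0 b) : (X 1 : Rp) ^ b ∈ I := by
  have h0 : f - cf f 0 b • mn 0 b = 0 := by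
    by_contra hne
    obtain ⟨p, q, hpq⟩ := exists_cf_ne_zero hne
    have hc : cf (f - cf f 0 b • mn 0 b) p q =
        cf f p q - cf f 0 b * if 0 = p ∧ b = q then 1 else 0 := by
      rw [← cf_mn]
      simp [cf]
    rw [hc] at hpq
    by_cases he : 0 = p ∧ b = q
    · obtain ⟨rfl, rfl⟩ := he
      simp at hpq
    · rw [if_neg he, mul_zero, sub_zero] at hpq
      have h₁ := hlead.2 _ _ hpq
      have h₂ := hlow.2 _ _ hpq
      omega
  have : cf f 0 b • mn 0 b ∈ I.restrictScalars ℂ := by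
    rw [← sub_eq_zero.1 h0]
    exact hf
  have := ((I.restrictScalars ℂ).smul_mem_iff hlow.1).1 this
  simpa [mn_eq] using this

/-- If `f⁰ = f₀ = x^a` then `x^a` lies in `I + (y)` for every ideal `I` containing `f`. -/
lemma X_zero_pow_mem {I : Ideal Rp} {f : Rp} (hf : f ∈ I) {a : ℕ} (hlead : IsLead f a 0)
    (hlow : IsLow f a 0) : (X 0 : Rp) ^ a ∈ I ⊔ Ideal.span {X 1} := by
  have hrest : f - cf f a 0 • mn a 0 ∈ (I ⊔ Ideal.span {X 1}).restrictScalars ℂ := by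
    refine mem_of_forall_mn_mem fun p q hpq => ?_
    have hc : cf (f - cf f a 0 • mn a 0) p q =
        cf f p q - cf f a 0 * if a = p ∧ 0 = q then 1 else 0 := by
      rw [← cf_mn]
      simp [cf]
    rw [hc] at hpq
    have hq : q ≠ 0 := by
      rintro rfl
      by_cases he : a = p
      · subst he
        simp at hpq
      · rw [if_neg (by tauto), mul_zero, sub_zero] at hpq
        have h₁ := hlead.2 _ _ hpq
        have h₂ := hlow.2 _ _ hpq
        omega
    refine Ideal.mem_sup_right (Ideal.mem_span_singleton.2 ?_)
    rw [mn_eq]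
    exact (dvd_pow_self _ hq).mul_left _
  have hfW : f ∈ (I ⊔ Ideal.span {X 1}).restrictScalars ℂ := Ideal.mem_sup_left hf
  have := Submodule.sub_mem _ hfW hrest
  rw [sub_sub_cancel] at this
  have hmem : mn a 0 ∈ I ⊔ Ideal.span {X 1} := (Submodule.smul_mem_iff _ hlow.1).1 this
  simpa [mn_eq] using hmem

theorem stmt5 (n : ℕ) (I : Ideal Rp) [FiniteDimensional ℂ (Rp ⧸ I)]
    (hdim : Module.finrank ℂ (Rp ⧸ I) = n)
    (ι : Type) (f : ι → Rp) (hgen : I = Ideal.span (Set.range f))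
    (htoplow : ∀ i : ι, ∃ a b : ℕ, IsLead (f i) a b ∧ IsLow (f i) a b)
    (hspan : Ibot I = Submodule.span ℂ
      {g : Rp | ∃ (i : ι) (a b a' b' : ℕ), IsLow (mn a b * f i) a' b' ∧ g = mn a' b'}) :
    Itop I = Ibot I ∧ (∀ g : Rp, g ∈ mId ^ n → g ∈ I) := by
  have hfI : ∀ i, f i ∈ I := fun i => hgen ▸ Ideal.subset_span ⟨i, rfl⟩
  have hlow : ∀ a b, (∃ g ∈ I, IsLow g a b) → ∃ i p q c d,
      IsLead (f i) c d ∧ IsLow (f i) c d ∧ a = p + c ∧ b = q + d := by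
    rintro a b ⟨g, hg, hgl⟩
    have hmem : mn a b ∈ Ibot I := Submodule.subset_span ⟨g, hg, a, b, hgl, rfl⟩
    have hset : {g : Rp | ∃ (i : ι) (a b a' b' : ℕ),
        IsLow (mn a b * f i) a' b' ∧ g = mn a' b'} =
        {g : Rp | ∃ a' b', (∃ i a b, IsLow (mn a b * f i) a' b') ∧ g = mn a' b'} := by
      ext g
      constructor
      · rintro ⟨i, a, b, a', b', h, rfl⟩
        exact ⟨a', b', ⟨i, a, b, h⟩, rfl⟩
      · rintro ⟨a', b', ⟨i, a, b, h⟩, rfl⟩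
        exact ⟨i, a, b, a', b', h, rfl⟩
    rw [hspan, hset] at hmem
    obtain ⟨i, p, q, hi⟩ := of_mem_span_mn hmem (a := a) (b := b) (by simp [cf_mn])
    obtain ⟨c, d, hcd, hcd'⟩ := htoplow i
    obtain ⟨h₁, h₂⟩ := hi.unique (hcd'.mn_mul p q)
    exact ⟨i, p, q, c, d, hcd, hcd', h₁, h₂⟩
  have hsub : ∀ a b, (∃ g ∈ I, IsLow g a b) → ∃ g ∈ I, IsLead g a b := by
    intro a b h
    obtain ⟨i, p, q, c, d, hcd, -, rfl, rfl⟩ := hlow a b h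
    exact ⟨_, I.mul_mem_left _ (hfI i), hcd.mn_mul p q⟩
  refine ⟨?_, ?_⟩
  · refine le_antisymm (Submodule.span_mono ?_) (Submodule.span_mono ?_)
    · rintro _ ⟨g, hg, a, b, h, rfl⟩
      obtain ⟨g', hg', h'⟩ := exists_isLow_of_isLead hsub ⟨g, hg, h⟩
      exact ⟨g', hg', a, b, h', rfl⟩
    · rintro _ ⟨g, hg, a, b, h, rfl⟩
      obtain ⟨g', hg', h'⟩ := hsub a b ⟨g, hg, h⟩
      exact ⟨g', hg', a, b, h', rfl⟩
  · have hy : X 1 ∈ I.radical := by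
      obtain ⟨k, hk⟩ := exists_isLow_of_injective (I := I) (a := fun _ => 0) (b := fun k => k)
        (fun _ _ h => (expPair_inj.1 h).2)
      obtain ⟨i, p, q, c, d, hcd, hcd', h₁, -⟩ := hlow _ _ hk
      obtain rfl : c = 0 := by omega
      exact ⟨d, X_one_pow_mem (hfI i) hcd hcd'⟩
    have hx : X 0 ∈ I.radical := by
      obtain ⟨k, hk⟩ := exists_isLow_of_injective (I := I) (a := fun k => k) (b := fun _ => 0)
        (fun _ _ h => (expPair_inj.1 h).1)
      obtain ⟨i, p, q, c, d, hcd, hcd', -, h₂⟩ := hlow _ _ hk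
      obtain rfl : d = 0 := by omega
      rw [← I.radical_idem]
      exact ⟨c, sup_le I.le_radical ((Ideal.span_singleton_le_iff_mem _).2 hy)
        (X_zero_pow_mem (hfI i) hcd hcd')⟩
    have hm : mId ≤ I.radical := by
      rw [mId, Ideal.span_le]
      rintro _ (rfl | rfl)
      · exact hx
      · exact hy
    obtain ⟨k, hk⟩ := Ideal.exists_pow_le_of_le_radical_of_fg hm (IsNoetherian.noetherian _)
    have hnil : IsNilpotent (mId.map (Ideal.Quotient.mk I)) :=
      ⟨k, by rw [← Ideal.map_pow]; exact (Ideal.map_eq_bot_iff_le_ker _).2 (by simpa using hk)⟩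
    have hbot := pow_finrank_eq_bot_of_isNilpotent (K := ℂ) hnil
    rw [hdim, ← Ideal.map_pow, Ideal.map_eq_bot_iff_le_ker, Ideal.mk_ker] at hbot
    exact fun g hg => hbot hg
end
end

section
/- Let R ⊆ ℂ[[z]] be a ℂ-subalgebra with δ := dim_ℂ ℂ[[z]]/R finite, and let M ⊆ ℂ[[z]] be an R-submodule with dim_ℂ ℂ[[z]]/M = δ and such that z^N ℂ[[z]] ⊆ M for some N ∈ ℕ. Then z^{2δ} ℂ[[z]] ⊆ M. -/
/- STATEMENT 14: Let R ⊆ ℂ[[z]] be a ℂ-subalgebra with δ = dim_ℂ ℂ[[z]]/R < ∞, and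
M ⊆ ℂ[[z]] an R-submodule with dim_ℂ ℂ[[z]]/M = δ and z^N ℂ[[z]] ⊆ M for some N.
Then z^{2δ} ℂ[[z]] ⊆ M. -/

noncomputable section

open PowerSeries in
/-- Exponents that are not orders of elements of `M` number at most the codimension of `M`. -/
theorem card_le_finrank_quotient_of_order_ne {K : Type*} [Field K] (M : Submodule K (PowerSeries K))
    [FiniteDimensional K (PowerSeries K ⧸ M)] (S : Finset ℕ)
    (hS : ∀ n ∈ S, ∀ f ∈ M, f.order ≠ n) :
    S.card ≤ Module.finrank K (PowerSeries K ⧸ M) := by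
  have hli : LinearIndependent K (fun n : S => M.mkQ ((X : PowerSeries K) ^ (n : ℕ))) := by
    rw [Fintype.linearIndependent_iff]
    intro c hc i
    simp only [← map_smul, ← map_sum] at hc
    rw [Submodule.mkQ_apply, Submodule.Quotient.mk_eq_zero] at hc
    by_contra hi
    set g : PowerSeries K := ∑ n : S, c n • (X : PowerSeries K) ^ (n : ℕ) with hg
    have hcoeff : ∀ m, coeff m g = ∑ n : S, if m = n then c n else 0 := by
      intro m
      simp [hg, coeff_X_pow]
    have hg0 : g ≠ 0 := by
      intro h0
      have := hcoeff i
      simp [h0] at this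
      exact hi this.symm
    obtain ⟨m, hm⟩ := ENat.ne_top_iff_exists.mp (mt order_eq_top.mp hg0)
    have hmS : m ∈ S := by
      by_contra hmS
      refine (order_eq_nat.mp hm.symm).1 ?_
      rw [hcoeff]
      refine Finset.sum_eq_zero fun n _ => if_neg ?_
      rintro rfl
      exact hmS n.2
    exact hS m hmS g hc hm.symm
  simpa using hli.fintype_card_le_finrank

open PowerSeries in
/-- A submodule containing all multiples of a power of `X` has finite codimension. -/
theorem finiteDimensional_quotient_of_X_pow_mul_mem {K : Type*} [Field K]
    (M : Submodule K (PowerSeries K)) (N : ℕ)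
    (h : ∀ f : PowerSeries K, (X : PowerSeries K) ^ N * f ∈ M) :
    FiniteDimensional K (PowerSeries K ⧸ M) := by
  let φ : PowerSeries K →ₗ[K] (Fin N → K) := LinearMap.pi fun i => coeff (i : ℕ)
  have hφ : LinearMap.ker φ ≤ M := by
    intro f hf
    obtain ⟨g, rfl⟩ : (X : PowerSeries K) ^ N ∣ f :=
      X_pow_dvd_iff.mpr fun m hm => congrFun (LinearMap.mem_ker.mp hf) ⟨m, hm⟩
    exact h g
  have : FiniteDimensional K (PowerSeries K ⧸ LinearMap.ker φ) :=
    Module.Finite.equiv φ.quotKerEquivRange.symm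
  exact Module.Finite.of_surjective (Submodule.factor hφ) (Submodule.factor_surjective hφ)

open PowerSeries in
/-- If `M` contains an element of order `n`, then a multiple of `X ^ n` can be reduced modulo `M`
to a multiple of `X ^ (n + 1)`. -/
theorem X_pow_mul_mem_of_succ {K : Type*} [Field K] (M : Submodule K (PowerSeries K)) (n : ℕ)
    (hn : ∃ m ∈ M, m.order = n) (h : ∀ f : PowerSeries K, (X : PowerSeries K) ^ (n + 1) * f ∈ M)
    (f : PowerSeries K) : (X : PowerSeries K) ^ n * f ∈ M := by
  obtain ⟨m, hm, hord⟩ := hn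
  obtain ⟨hc, hlt⟩ := order_eq_nat.mp hord
  obtain ⟨u, rfl⟩ := X_pow_dvd_iff.mpr hlt
  have hu : constantCoeff u ≠ 0 := by simpa [coeff_X_pow_mul'] using hc
  set a := constantCoeff f / constantCoeff u with ha
  obtain ⟨g, hg⟩ : (X : PowerSeries K) ∣ f - a • u := by
    rw [X_dvd_iff]
    simp [smul_eq_C_mul, ha, hu]
  have hf : (X : PowerSeries K) ^ n * f = X ^ (n + 1) * g + a • (X ^ n * u) := by
    rw [pow_succ, mul_assoc, ← hg, mul_sub, mul_smul_comm, sub_add_cancel]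
  rw [hf]
  exact M.add_mem (h g) (M.smul_mem a hm)

open PowerSeries in
/-- Every `n` at least the sum of the codimensions of `R` and `M` is the order of an element
of `M`. -/
theorem exists_mem_order_eq {K : Type*} [Field K] (R M : Submodule K (PowerSeries K))
    [FiniteDimensional K (PowerSeries K ⧸ R)] [FiniteDimensional K (PowerSeries K ⧸ M)]
    (hRM : ∀ r ∈ R, ∀ f ∈ M, r * f ∈ M) (n : ℕ)
    (hn : Module.finrank K (PowerSeries K ⧸ R) + Module.finrank K (PowerSeries K ⧸ M) ≤ n) :
    ∃ m ∈ M, m.order = n := by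
  classical
  by_contra! hno
  let P : ℕ → Prop := fun d => ∃ f ∈ M, f.order = d
  let A := (Finset.range (n + 1)).filter P
  let B := (Finset.range (n + 1)).filter fun d => ¬ P d
  have hAB : A.card + B.card = n + 1 := by
    simpa using Finset.card_filter_add_card_filter_not (s := Finset.range (n + 1)) P
  have hB : B.card ≤ Module.finrank K (PowerSeries K ⧸ M) := by
    refine card_le_finrank_quotient_of_order_ne M B fun d hd f hf hfd => ?_
    exact (Finset.mem_filter.mp hd).2 ⟨f, hf, hfd⟩
  have hA : (A.image (n - ·)).card ≤ Module.finrank K (PowerSeries K ⧸ R) := by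
    refine card_le_finrank_quotient_of_order_ne R _ fun e he r hr hre => ?_
    obtain ⟨d, hd, rfl⟩ := Finset.mem_image.mp he
    obtain ⟨hdn, f, hf, hfd⟩ := Finset.mem_filter.mp hd
    refine hno (r * f) (hRM r hr f hf) ?_
    rw [order_mul, hre, hfd, ← Nat.cast_add, Nat.sub_add_cancel]
    exact Nat.lt_succ_iff.mp (Finset.mem_range.mp hdn)
  rw [Finset.card_image_of_injOn] at hA
  · omega
  · intro a ha b hb hab
    have ha' := Finset.mem_range.mp (Finset.mem_filter.mp ha).1
    have hb' := Finset.mem_range.mp (Finset.mem_filter.mp hb).1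
    simp only at hab
    omega

theorem stmt14 (R : Subalgebra ℂ (PowerSeries ℂ))
    [FiniteDimensional ℂ (PowerSeries ℂ ⧸ Subalgebra.toSubmodule R)]
    (δ : ℕ) (hδ : Module.finrank ℂ (PowerSeries ℂ ⧸ Subalgebra.toSubmodule R) = δ)
    (M : Submodule ℂ (PowerSeries ℂ))
    (hRM : ∀ r ∈ R, ∀ f ∈ M, r * f ∈ M)
    (hMdim : Module.finrank ℂ (PowerSeries ℂ ⧸ M) = δ)
    (N : ℕ) (hNM : ∀ f : PowerSeries ℂ, PowerSeries.X ^ N * f ∈ M) :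
    ∀ f : PowerSeries ℂ, PowerSeries.X ^ (2 * δ) * f ∈ M := by
  have := finiteDimensional_quotient_of_X_pow_mul_mem M N hNM
  have step : ∀ k, ∀ f : PowerSeries ℂ, PowerSeries.X ^ (2 * δ + (N - k)) * f ∈ M := by
    intro k
    induction k with
    | zero =>
      intro f
      have h := hNM (PowerSeries.X ^ (2 * δ) * f)
      rwa [← mul_assoc, ← pow_add, add_comm] at h
    | succ k ih =>
      rcases Nat.lt_or_ge k N with hk | hk
      · refine X_pow_mul_mem_of_succ M _
          (exists_mem_order_eq (Subalgebra.toSubmodule R) M hRM _ (by omega)) ?_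
        rwa [show 2 * δ + (N - (k + 1)) + 1 = 2 * δ + (N - k) by omega]
      · rwa [show N - (k + 1) = N - k by omega]
  simpa using step N
end
end

section
/- Let Γ ⊆ ℕ be a numerical semigroup (0 ∈ Γ, closed under addition, ℕ∖Γ finite) with δ := |ℕ∖Γ|, and assume Γ is symmetric: for every integer k, k ∈ Γ if and only if 2δ−1−k ∉ Γ. Let Δ ⊆ ℕ be nonempty with Γ + Δ ⊆ Δ, and define Δ* := {p ∈ ℕ : p + d ∈ Γ for all d ∈ Δ}. Then Δ* = {2δ−1−g : g ∈ ℕ∖Δ, g ≤ 2δ−1} ∪ {k ∈ ℕ : k ≥ 2δ}. -/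
/- STATEMENT 15: Let Γ ⊆ ℕ be a symmetric numerical semigroup with δ gaps
(k ∈ Γ ⟺ 2δ−1−k ∉ Γ, for all integers k), and Δ ⊆ ℕ nonempty with Γ + Δ ⊆ Δ. Then
Δ* = {p ∈ ℕ : p + Δ ⊆ Γ} equals {2δ−1−g : g ∈ ℕ∖Δ, g ≤ 2δ−1} ∪ {k ∈ ℕ : k ≥ 2δ}. -/

noncomputable section

theorem stmt15 (Γ : Set ℕ) (h0 : (0 : ℕ) ∈ Γ)
    (hadd : ∀ x ∈ Γ, ∀ y ∈ Γ, x + y ∈ Γ)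
    (hfin : {k : ℕ | k ∉ Γ}.Finite)
    (δ : ℕ) (hδ : {k : ℕ | k ∉ Γ}.ncard = δ)
    (hsym : ∀ k : ℤ, (∃ m : ℕ, (m : ℤ) = k ∧ m ∈ Γ) ↔
      ¬ ∃ m : ℕ, (m : ℤ) = 2 * (δ : ℤ) - 1 - k ∧ m ∈ Γ)
    (Δ : Set ℕ) (hne : Δ.Nonempty)
    (hmod : ∀ γ ∈ Γ, ∀ d ∈ Δ, γ + d ∈ Δ) :
    {p : ℕ | ∀ d ∈ Δ, p + d ∈ Γ} =
      {q : ℕ | ∃ g : ℕ, g ∉ Δ ∧ (q : ℤ) = 2 * (δ : ℤ) - 1 - (g : ℤ)} ∪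
      {k : ℕ | 2 * δ ≤ k} := by
  ext p
  simp only [Set.mem_ofPred_eq, Set.mem_union]
  constructor
  · intro hp
    rcases Nat.lt_or_ge p (2 * δ) with h | h
    · refine Or.inl ⟨2 * δ - 1 - p, fun hg => ?_, by omega⟩
      exact (hsym (2 * δ - 1)).1 ⟨_, by omega, hp _ hg⟩ ⟨0, by simp, h0⟩
    · exact Or.inr h
  · intro hp d hd
    have hsum : ∃ m : ℕ, (m : ℤ) = (p + d : ℕ) ∧ m ∈ Γ := by
      refine (hsym _).2 ?_
      rintro ⟨m, hm, hmΓ⟩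
      rcases hp with ⟨g, hg, hpg⟩ | hp
      · have hgm : g = m + d := by omega
        exact hg (hgm ▸ hmod m hmΓ d hd)
      · omega
    obtain ⟨m, hm, hmΓ⟩ := hsum
    exact Nat.cast_injective hm ▸ hmΓ
end
end
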